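/- Let Ĝ^d be a swap-maximal loopy graph whose largest clique K^0 contained in V^0 has exactly d vertices. If d > 3, then every edge of Ĝ^d (including self-loops) has at least one endpoint in V^0 ∪ V^1; if d = 3, then every edge of Ĝ^3 that is not a self-loop has at least one endpoint in V^0 ∪ V^1. -/

import Mathlib

open scoped Classical

/-- A loopy graph: at most one edge between any two distinct vertices and at most one
self-loop at each vertex, encoded as a symmetric adjacency relation. -/
structure LoopyGraph (V : Type) where
  Adj : V → V → Prop
  symm : ∀ u v : V, Adj u v → Adj v u

namespace LoopyGraph

variable {V : Type}

/-- The neighbors of `u` (vertices other than `u` adjacent to `u`). -/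
def nbr (G : LoopyGraph V) (u : V) : Set V := {v | v ≠ u ∧ G.Adj u v}

/-- Degree of a vertex: each self-loop contributes `2`. -/
noncomputable def deg (G : LoopyGraph V) (u : V) : ℕ :=
  (G.nbr u).ncard + (if G.Adj u u then 2 else 0)

/-- `G₂` is obtained from `G₁` by a single valid double edge swap
`(u,v),(x,y) ⤳ (u,x),(v,y)`: the two removed edges are distinct edges of `G₁`, the two
added edges are distinct and not already present (no multiedge and no doubled
self-loop is created). -/
def DoubleEdgeSwap (G₁ G₂ : LoopyGraph V) : Prop :=
  ∃ u v x y : V,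
    G₁.Adj u v ∧ G₁.Adj x y ∧
    s(u, v) ≠ s(x, y) ∧
    ¬ G₁.Adj u x ∧ ¬ G₁.Adj v y ∧ s(u, x) ≠ s(v, y) ∧
    ∀ a b : V, G₂.Adj a b ↔
      ((G₁.Adj a b ∧ s(a, b) ≠ s(u, v) ∧ s(a, b) ≠ s(x, y)) ∨
        s(a, b) = s(u, x) ∨ s(a, b) = s(v, y))

/-- `G₂` is reachable from `G₁` by a finite sequence of valid double edge swaps. -/
def Reach (G₁ G₂ : LoopyGraph V) : Prop :=
  Relation.ReflTransGen DoubleEdgeSwap G₁ G₂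

/-- Vertices at (shortest-path) distance at most `k` from the set of loop-free vertices. -/
def within (G : LoopyGraph V) : ℕ → Set V
  | 0 => {v | ¬ G.Adj v v}
  | (k + 1) => within G k ∪ {v | ∃ u ∈ within G k, G.Adj v u}

/-- `Vset G 0 = V^0` is the set of vertices with no self-loop; for `k ≥ 1`,
`Vset G k = V^k` is the set of vertices (necessarily carrying a self-loop) whose
shortest-path distance to `V^0` is exactly `k`. -/
def Vset (G : LoopyGraph V) : ℕ → Set V
  | 0 => {v | ¬ G.Adj v v}
  | (k + 1) => within G (k + 1) \ within G k

/-- `V^∞`: vertices (with a self-loop) having no path to `V^0`. -/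
def Vinf (G : LoopyGraph V) : Set V := {v | ∀ k : ℕ, v ∉ within G k}

/-- A set of vertices is a clique when all pairs of distinct members are adjacent. -/
def IsClique (G : LoopyGraph V) (s : Set V) : Prop :=
  ∀ x ∈ s, ∀ y ∈ s, x ≠ y → G.Adj x y

/-- The set of vertices carrying a self-loop. -/
def selfLoops (G : LoopyGraph V) : Set V := {v | G.Adj v v}

/-- The edges of `G` with both endpoints in `V^0`. -/
def V0edges (G : LoopyGraph V) : Set (Sym2 V) :=
  {e | ∃ u v : V, e = s(u, v) ∧ G.Adj u v ∧ u ∈ Vset G 0 ∧ v ∈ Vset G 0}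

/-- `Ĝ` is swap-maximal: among all loopy graphs reachable from it by double edge swaps it
has the maximum number of self-loops, and subject to that the maximum number of edges with
both endpoints in `V^0`. -/
def SwapMaximal (G : LoopyGraph V) : Prop :=
  ∀ H : LoopyGraph V, Reach G H →
    (selfLoops H).ncard ≤ (selfLoops G).ncard ∧
      ((selfLoops H).ncard = (selfLoops G).ncard →
        (V0edges H).ncard ≤ (V0edges G).ncard)

/-- `K` is a largest clique contained in `V^0`, and it has exactly `d` vertices. -/
def LargestV0Clique (G : LoopyGraph V) (K : Set V) (d : ℕ) : Prop :=
  K ⊆ Vset G 0 ∧ IsClique G K ∧ K.ncard = d ∧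
    ∀ K' : Set V, K' ⊆ Vset G 0 → IsClique G K' → K'.ncard ≤ d

/-- Class `Q1`. -/
def Q1 (G : LoopyGraph V) : Prop :=
  ∃ K : Set V, K ⊆ Vset G 0 ∧ 4 ≤ K.ncard ∧ IsClique G K ∧
    (∀ u ∈ Vset G 0, (∀ w ∈ Vset G 0, ¬ G.Adj u w) ∨ u ∈ K) ∧
    IsClique G (Vset G 1 ∪ K) ∧
    Vset G 2 = ∅ ∧ Vinf G = ∅

/-- Class `Q2`. -/
def Q2 (G : LoopyGraph V) : Prop :=
  3 ≤ {u | u ∈ Vset G 0 ∧ (nbr G u ∩ Vset G 0).ncard = 2}.ncard ∧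
  (∀ u ∈ Vset G 0,
      (∀ w ∈ Vset G 0, ¬ G.Adj u w) ∨
        ((nbr G u ∩ Vset G 0).ncard = 2 ∧ ∀ w ∈ Vset G 1, G.Adj u w)) ∧
  IsClique G (Vset G 1) ∧
  (∀ u ∈ Vset G 2, nbr G u = Vset G 1) ∧
  Vset G 3 = ∅ ∧
  (Vinf G = ∅ ∨ (Vset G 1 = ∅ ∧ ∀ u ∈ Vinf G, deg G u = 2))

/-- The graph of loopy graphs `𝒢({k_i})` is connected: any two loopy graphs with degree
sequence `k` are linked by a finite sequence of valid double edge swaps. -/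
def GConnected (k : V → ℕ) : Prop :=
  ∀ G₁ G₂ : LoopyGraph V, (∀ v, deg G₁ v = k v) → (∀ v, deg G₂ v = k v) →
    Reach G₁ G₂

/-- `G₂` is obtained from `G₁` by a single valid triangle-loop swap: either a triangle on
three distinct vertices is replaced by three self-loops, or conversely. -/
def TriangleLoopSwap (G₁ G₂ : LoopyGraph V) : Prop :=
  ∃ u v w : V, u ≠ v ∧ v ≠ w ∧ u ≠ w ∧
    ((G₁.Adj u v ∧ G₁.Adj v w ∧ G₁.Adj w u ∧
        ¬ G₁.Adj u u ∧ ¬ G₁.Adj v v ∧ ¬ G₁.Adj w w ∧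
        ∀ a b : V, G₂.Adj a b ↔
          ((G₁.Adj a b ∧ s(a, b) ≠ s(u, v) ∧ s(a, b) ≠ s(v, w) ∧ s(a, b) ≠ s(w, u)) ∨
            s(a, b) = s(u, u) ∨ s(a, b) = s(v, v) ∨ s(a, b) = s(w, w))) ∨
      (G₁.Adj u u ∧ G₁.Adj v v ∧ G₁.Adj w w ∧
        ¬ G₁.Adj u v ∧ ¬ G₁.Adj v w ∧ ¬ G₁.Adj w u ∧
        ∀ a b : V, G₂.Adj a b ↔
          ((G₁.Adj a b ∧ s(a, b) ≠ s(u, u) ∧ s(a, b) ≠ s(v, v) ∧ s(a, b) ≠ s(w, w)) ∨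
            s(a, b) = s(u, v) ∨ s(a, b) = s(v, w) ∨ s(a, b) = s(w, u))))

/-- Reachability in the augmented graph of loopy graphs `𝒢_△`: a finite sequence of moves,
each a valid double edge swap or a valid triangle-loop swap. -/
def ReachTri (G₁ G₂ : LoopyGraph V) : Prop :=
  Relation.ReflTransGen
    (fun H₁ H₂ => DoubleEdgeSwap H₁ H₂ ∨ TriangleLoopSwap H₁ H₂) G₁ G₂

/-- `S` is a set of highest-degree vertices for the degree sequence `k`. -/
def TopSet (k : V → ℕ) (S : Set V) : Prop :=
  ∀ u ∈ S, ∀ v : V, v ∉ S → k v ≤ k u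

/-- A loopy graph is simple when it has no self-loops. -/
def IsSimple (G : LoopyGraph V) : Prop := ∀ v : V, ¬ G.Adj v v

/-- `k` is the degree sequence of some simple graph. -/
def SimpleGraphical (k : V → ℕ) : Prop :=
  ∃ G : LoopyGraph V, IsSimple G ∧ ∀ v, deg G v = k v

/-- `k` is `m`-simple-graphical: subtracting `2` from each of the `m` largest entries
yields a simple-graphical sequence. -/
def MSimpleGraphical (k : V → ℕ) (m : ℕ) : Prop :=
  ∃ S : Set V, S.ncard = m ∧ TopSet k S ∧ (∀ v ∈ S, 2 ≤ k v) ∧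
    SimpleGraphical (fun v : V => if v ∈ S then k v - 2 else k v)

/-- `m` is `m*`, the maximum `m` for which the sequence is `m`-simple-graphical. -/
def IsMStar (k : V → ℕ) (m : ℕ) : Prop :=
  MSimpleGraphical k m ∧ ∀ m' : ℕ, MSimpleGraphical k m' → m' ≤ m

/-- `G` is `m`-loopy: it has self-loops exactly at `m` highest-degree vertices. -/
def MLoopy (G : LoopyGraph V) (m : ℕ) : Prop :=
  (selfLoops G).ncard = m ∧ TopSet (deg G) (selfLoops G)

end LoopyGraph

namespace LoopyGraph

variable {V : Type}

/-- The graph obtained by replacing the edges `(u,v), (x,y)` by `(u,x), (v,y)`. -/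
def swap (G : LoopyGraph V) (u v x y : V) : LoopyGraph V where
  Adj a b := (G.Adj a b ∧ s(a, b) ≠ s(u, v) ∧ s(a, b) ≠ s(x, y)) ∨
    s(a, b) = s(u, x) ∨ s(a, b) = s(v, y)
  symm a b h := by
    rw [Sym2.eq_swap (a := b)]
    exact h.imp_left fun h => ⟨G.symm _ _ h.1, h.2⟩

theorem doubleEdgeSwap_swap {G : LoopyGraph V} {u v x y : V} (huv : G.Adj u v)
    (hxy : G.Adj x y) (hne : s(u, v) ≠ s(x, y)) (hux : ¬ G.Adj u x) (hvy : ¬ G.Adj v y)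
    (hne' : s(u, x) ≠ s(v, y)) : DoubleEdgeSwap G (G.swap u v x y) :=
  ⟨u, v, x, y, huv, hxy, hne, hux, hvy, hne', fun _ _ => Iff.rfl⟩

/-- An induced path `y - x - z` at a loop-free vertex `x` can be traded for a self-loop at `x`
and the edge `(y,z)`. -/
theorem doubleEdgeSwap_swap_path {G : LoopyGraph V} {x y z : V} (hxy : G.Adj x y)
    (hxz : G.Adj x z) (hx : ¬ G.Adj x x) (hyz : ¬ G.Adj y z) (hne : y ≠ z) :
    DoubleEdgeSwap G (G.swap x y x z) := by
  have hyx : y ≠ x := by rintro rfl; exact hx hxy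
  refine doubleEdgeSwap_swap hxy hxz ?_ hx hyz ?_ <;> grind [Sym2.eq_iff]

theorem selfLoops_swap_path {G : LoopyGraph V} {x y z : V} (hxy : G.Adj x y)
    (hxz : G.Adj x z) (hx : ¬ G.Adj x x) (hne : y ≠ z) :
    selfLoops (G.swap x y x z) = insert x (selfLoops G) := by
  have hyx : y ≠ x := by rintro rfl; exact hx hxy
  have hzx : z ≠ x := by rintro rfl; exact hx hxz
  ext a
  simp only [selfLoops, swap, Set.mem_ofPred_eq, Set.mem_insert_iff, Sym2.eq_iff, ne_eq]
  grind

theorem ncard_selfLoops_swap_path [Finite V] {G : LoopyGraph V} {x y z : V} (hxy : G.Adj x y)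
    (hxz : G.Adj x z) (hx : ¬ G.Adj x x) (hne : y ≠ z) :
    (selfLoops (G.swap x y x z)).ncard = (selfLoops G).ncard + 1 := by
  rw [selfLoops_swap_path hxy hxz hx hne]
  exact Set.ncard_insert_of_notMem hx (Set.toFinite _)

/-- A vertex outside `V^0 ∪ V^1` carries a self-loop and has no neighbor in `V^0`. -/
theorem adj_self_and_not_adj_of_notMem {G : LoopyGraph V} {a : V}
    (ha : a ∉ Vset G 0 ∪ Vset G 1) : G.Adj a a ∧ ∀ u ∈ Vset G 0, ¬ G.Adj u a := by
  simp only [Vset, within, Set.mem_union, Set.mem_sdiff, Set.mem_ofPred_eq] at ha ⊢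
  push Not at ha
  exact ⟨ha.1, fun u hu hua => (ha.2 (Or.inr ⟨u, hu, G.symm _ _ hua⟩)) ha.1⟩

/-- A swap-maximal graph with a triangle in `V^0` has no non-loop edge avoiding
`V^0 ∪ V^1`. -/
theorem SwapMaximal.false_of_triangle [Finite V] {G : LoopyGraph V} (hmax : G.SwapMaximal)
    {u v w a b : V} (hu : u ∈ Vset G 0) (hv : v ∈ Vset G 0) (hw : w ∈ Vset G 0)
    (huv : G.Adj u v) (hwu : G.Adj w u) (hwv : G.Adj w v) (hab : G.Adj a b) (hne : a ≠ b)
    (ha : a ∉ Vset G 0 ∪ Vset G 1) (hb : b ∉ Vset G 0 ∪ Vset G 1) : False := by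
  obtain ⟨haa, ha⟩ := adj_self_and_not_adj_of_notMem ha
  obtain ⟨hbb, hb⟩ := adj_self_and_not_adj_of_notMem hb
  have hua := ha u hu
  have hvb := hb v hv
  simp only [Vset, Set.mem_ofPred_eq] at hu hv hw
  have huv' : u ≠ v := by grind
  have hwu' : w ≠ u := by grind
  have hwv' : w ≠ v := by grind
  have hua' : u ≠ a := by grind
  have hub' : u ≠ b := by grind
  have hva' : v ≠ a := by grind
  have hvb' : v ≠ b := by grind
  have hwa' : w ≠ a := by grind
  have hwb' : w ≠ b := by grind
  have h₁ : DoubleEdgeSwap G (G.swap u v a b) := by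
    refine doubleEdgeSwap_swap huv hab ?_ hua hvb ?_ <;> grind [Sym2.eq_iff]
  have hloops : selfLoops (G.swap u v a b) = selfLoops G := by
    ext c
    simp only [selfLoops, swap, Set.mem_ofPred_eq, Sym2.eq_iff, ne_eq]
    grind
  have k₁ : (G.swap u v a b).Adj w u := by
    simp only [swap, Sym2.eq_iff, ne_eq]; grind
  have k₂ : (G.swap u v a b).Adj w v := by
    simp only [swap, Sym2.eq_iff, ne_eq]; grind
  have k₃ : ¬ (G.swap u v a b).Adj w w := by
    simp only [swap, Sym2.eq_iff, ne_eq]; grind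
  have k₄ : ¬ (G.swap u v a b).Adj u v := by
    simp only [swap, Sym2.eq_iff, ne_eq]; grind
  have h₂ := doubleEdgeSwap_swap_path k₁ k₂ k₃ k₄ huv'
  have hle := (hmax _ (.tail (.single h₁) h₂)).1
  rw [ncard_selfLoops_swap_path k₁ k₂ k₃ huv', hloops] at hle
  omega

/-- A swap-maximal graph with a 4-clique in `V^0` has no self-loop outside `V^0 ∪ V^1`. -/
theorem SwapMaximal.false_of_four_clique [Finite V] {G : LoopyGraph V} (hmax : G.SwapMaximal)
    {u v w z a : V} (hu : u ∈ Vset G 0) (hv : v ∈ Vset G 0) (hw : w ∈ Vset G 0)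
    (hz : z ∈ Vset G 0) (huv : G.Adj u v) (hwu : G.Adj w u) (hwv : G.Adj w v)
    (huz : G.Adj u z) (hwz : w ≠ z) (hvz : v ≠ z)
    (ha : a ∉ Vset G 0 ∪ Vset G 1) : False := by
  obtain ⟨haa, ha⟩ := adj_self_and_not_adj_of_notMem ha
  have hua := ha u hu
  have hva := ha v hv
  have hza := mt (G.symm a z) (ha z hz)
  simp only [Vset, Set.mem_ofPred_eq] at hu hv hw hz
  have huv' : u ≠ v := by grind
  have hwu' : w ≠ u := by grind
  have hwv' : w ≠ v := by grind
  have huz' : u ≠ z := by grind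
  have hua' : u ≠ a := by grind
  have hva' : v ≠ a := by grind
  have hwa' : w ≠ a := by grind
  have hza' : a ≠ z := by grind
  have h₁ : DoubleEdgeSwap G (G.swap u v a a) := by
    refine doubleEdgeSwap_swap huv haa ?_ hua hva ?_ <;> grind [Sym2.eq_iff]
  have hloops : selfLoops (G.swap u v a a) = selfLoops G \ {a} := by
    ext c
    simp only [selfLoops, swap, Set.mem_ofPred_eq, Sym2.eq_iff, ne_eq, Set.mem_sdiff,
      Set.mem_singleton_iff]
    grind
  have hcard : (selfLoops (G.swap u v a a)).ncard + 1 = (selfLoops G).ncard := by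
    rw [hloops]
    exact Set.ncard_sdiff_singleton_add_one haa (Set.toFinite _)
  have k₁ : (G.swap u v a a).Adj w u := by
    simp only [swap, Sym2.eq_iff, ne_eq]; grind
  have k₂ : (G.swap u v a a).Adj w v := by
    simp only [swap, Sym2.eq_iff, ne_eq]; grind
  have k₃ : ¬ (G.swap u v a a).Adj w w := by
    simp only [swap, Sym2.eq_iff, ne_eq]; grind
  have k₄ : ¬ (G.swap u v a a).Adj u v := by
    simp only [swap, Sym2.eq_iff, ne_eq]; grind
  have h₂ := doubleEdgeSwap_swap_path k₁ k₂ k₃ k₄ huv'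
  have m₁ : ((G.swap u v a a).swap w u w v).Adj u a := by
    simp only [swap, Sym2.eq_iff, ne_eq]; grind
  have m₂ : ((G.swap u v a a).swap w u w v).Adj u z := by
    simp only [swap, Sym2.eq_iff, ne_eq]; grind
  have m₃ : ¬ ((G.swap u v a a).swap w u w v).Adj u u := by
    simp only [swap, Sym2.eq_iff, ne_eq]; grind
  have m₄ : ¬ ((G.swap u v a a).swap w u w v).Adj a z := by
    simp only [swap, Sym2.eq_iff, ne_eq]; grind
  have h₃ := doubleEdgeSwap_swap_path m₁ m₂ m₃ m₄ hza'
  have hle := (hmax _ (.tail (.tail (.single h₁) h₂) h₃)).1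
  rw [ncard_selfLoops_swap_path m₁ m₂ m₃ hza', ncard_selfLoops_swap_path k₁ k₂ k₃ huv'] at hle
  omega

end LoopyGraph

/-- In a swap-maximal loopy graph `Ĝ^d`: if `d > 3`, every edge (including
self-loops) has an endpoint in `V^0 ∪ V^1`; if `d = 3`, every non-self-loop edge has an
endpoint in `V^0 ∪ V^1`. -/
theorem swap_maximal_edges_touch_V0V1 {V : Type} [Fintype V] (G : LoopyGraph V)
    (hmax : G.SwapMaximal) (K : Set V) (d : ℕ)
    (hK : LoopyGraph.LargestV0Clique G K d) :
    (3 < d → ∀ a b : V, G.Adj a b →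
        a ∈ LoopyGraph.Vset G 0 ∪ LoopyGraph.Vset G 1 ∨
          b ∈ LoopyGraph.Vset G 0 ∪ LoopyGraph.Vset G 1) ∧
    (d = 3 → ∀ a b : V, G.Adj a b → a ≠ b →
        a ∈ LoopyGraph.Vset G 0 ∪ LoopyGraph.Vset G 1 ∨
          b ∈ LoopyGraph.Vset G 0 ∪ LoopyGraph.Vset G 1) := by
  obtain ⟨hK0, hKc, hcard, -⟩ := hK
  have edge : 2 < K.ncard → ∀ a b : V, G.Adj a b → a ≠ b →
      a ∈ LoopyGraph.Vset G 0 ∪ LoopyGraph.Vset G 1 ∨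
        b ∈ LoopyGraph.Vset G 0 ∪ LoopyGraph.Vset G 1 := by
    intro h3 a b hab hne
    by_contra! hcon
    obtain ⟨u, v, w, hu, hv, hw, huv, huw, hvw⟩ := (Set.two_lt_ncard_iff (Set.toFinite K)).1 h3
    exact hmax.false_of_triangle (hK0 hu) (hK0 hv) (hK0 hw) (hKc _ hu _ hv huv)
      (hKc _ hw _ hu huw.symm) (hKc _ hw _ hv hvw.symm) hab hne hcon.1 hcon.2
  refine ⟨fun hd a b hab => ?_, fun hd => edge (by omega)⟩
  by_cases hne : a = b
  · subst hne
    by_contra! hcon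
    obtain ⟨u, v, w, hu, hv, hw, huv, huw, hvw⟩ :=
      (Set.two_lt_ncard_iff (Set.toFinite K)).1 (by omega)
    obtain ⟨z, hz, hz'⟩ : ∃ z ∈ K, z ∉ ({u, v, w} : Set V) := by
      refine Set.exists_mem_notMem_of_ncard_lt_ncard ?_ (Set.toFinite _)
      have := Set.ncard_eq_three.2 ⟨u, v, w, huv, huw, hvw, rfl⟩
      omega
    simp only [Set.mem_insert_iff, Set.mem_singleton_iff, not_or] at hz'
    exact hmax.false_of_four_clique (hK0 hu) (hK0 hv) (hK0 hw) (hK0 hz) (hKc _ hu _ hv huv)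
      (hKc _ hw _ hu huw.symm) (hKc _ hw _ hv hvw.symm)
      (hKc _ hu _ hz (Ne.symm hz'.1)) (Ne.symm hz'.2.2) (Ne.symm hz'.2.1) hcon.1
  · exact edge (by omega) a b hab hne
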